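/- Let X be a set with a bornology B having an increasing countable basis {D_n}. Let E ⊆ X × X and A, B ⊆ X be such that for every bounded set D ∈ B, [(A \ D) × (B \ D)] ∩ E ≠ ∅. Then there exist countable unbounded subsets A₀ ⊆ A and B₀ ⊆ B such that for every bounded D, [(A₀ \ D) × (B₀ \ D)] ∩ E ≠ ∅. -/

import Mathlib

/-- A bornology on a set `X`. -/
structure SetBornology (X : Type*) where
  sets : Set (Set X)
  nonempty : sets.Nonempty
  subset_mem : ∀ {A B : Set X}, A ∈ sets → B ⊆ A → B ∈ sets
  union_mem : ∀ {A B : Set X}, A ∈ sets → B ∈ sets → A ∪ B ∈ sets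
  singleton_mem : ∀ x : X, {x} ∈ sets

/-- `A` is a basis for the bornology `B`. -/
def SetBornology.IsBasis {X : Type*} (B : SetBornology X) (A : Set (Set X)) : Prop :=
  A ⊆ B.sets ∧ ∀ S ∈ B.sets, ∃ T ∈ A, S ⊆ T

/-- If the bornology has an increasing countable basis and
`[(A \ D) × (B \ D)] ∩ E ≠ ∅` for every bounded `D`, then there are countable
unbounded `A₀ ⊆ A`, `B₀ ⊆ B` with the same property. -/
theorem stmt_8 {X : Type*} (Bor : SetBornology X) (D : ℕ → Set X)
    (hbasis : Bor.IsBasis (Set.range D)) (hmono : ∀ n, D n ⊆ D (n + 1))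
    (E : Set (X × X)) (A B : Set X)
    (h : ∀ Dd ∈ Bor.sets, (((A \ Dd) ×ˢ (B \ Dd)) ∩ E).Nonempty) :
    ∃ A₀ ⊆ A, ∃ B₀ ⊆ B,
      A₀.Countable ∧ B₀.Countable ∧ A₀ ∉ Bor.sets ∧ B₀ ∉ Bor.sets ∧
      ∀ Dd ∈ Bor.sets, (((A₀ \ Dd) ×ˢ (B₀ \ Dd)) ∩ E).Nonempty := by
  have hsep : ∀ n, ∃ p : X × X, p ∈ ((A \ D n) ×ˢ (B \ D n)) ∩ E :=
    fun n => h _ (hbasis.1 ⟨n, rfl⟩)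
  choose p hp using hsep
  have hmeet : ∀ S ∈ Bor.sets, (((Set.range (fun n => (p n).1) \ S) ×ˢ
      (Set.range (fun n => (p n).2) \ S)) ∩ E).Nonempty := by
    intro S hS
    obtain ⟨_, ⟨n, rfl⟩, hSn⟩ := hbasis.2 S hS
    exact ⟨p n, ⟨⟨⟨n, rfl⟩, fun hx => (hp n).1.1.2 (hSn hx)⟩,
      ⟨⟨n, rfl⟩, fun hy => (hp n).1.2.2 (hSn hy)⟩⟩, (hp n).2⟩
  refine ⟨Set.range fun n => (p n).1, ?_, Set.range fun n => (p n).2, ?_,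
    Set.countable_range _, Set.countable_range _, fun hA => ?_, fun hB => ?_, hmeet⟩
  · rintro _ ⟨n, rfl⟩
    exact (hp n).1.1.1
  · rintro _ ⟨n, rfl⟩
    exact (hp n).1.2.1
  · obtain ⟨_, ⟨⟨hx, hnx⟩, _⟩, _⟩ := hmeet _ hA
    exact hnx hx
  · obtain ⟨_, ⟨_, ⟨hy, hny⟩⟩, _⟩ := hmeet _ hB
    exact hny hy
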